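/- arXiv:1806.03727 — 2 statements merged into one kernel-verified Lean document; each statement's English description precedes it below -/
import Mathlib

section
/- Let n ≥ 2 and let y_1, …, y_m ∈ 𝕊^n be m distinct points containing no antipodal pair (i.e. y_i ≠ -y_j for all i, j). Let c_0, c_1, …, c_m be real numbers such that (c_1, …, c_m) ≠ (0,…,0). Then the set { x ∈ 𝕊^n : c_0 + Σ_{j=1}^{m} c_j · d(x,y_j) = 0 } has σ-measure zero. -/
/-- The unit sphere `𝕊^n ⊂ ℝ^{n+1}`. -/
def unitSphere (n : ℕ) : Set (EuclideanSpace ℝ (Fin (n + 1))) := Metric.sphere 0 1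

/-- The great-circle distance `d(x,y) = arccos⟨x,y⟩` on the unit sphere. -/
noncomputable def gcDist {n : ℕ} (x y : EuclideanSpace ℝ (Fin (n + 1))) : ℝ :=
  Real.arccos (@inner ℝ _ _ x y)

open MeasureTheory

/-- The uniform surface measure on `𝕊^n`: the `n`-dimensional Hausdorff measure
restricted to the unit sphere. -/
noncomputable def sphereMeasure (n : ℕ) : Measure (EuclideanSpace ℝ (Fin (n + 1))) :=
  (μH[(n : ℝ)]).restrict (unitSphere n)

open Set Filter Topology Metric Module

section NullSets

variable {E : Type*} [NormedAddCommGroup E] [NormedSpace ℝ E] [FiniteDimensional ℝ E]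
  [MeasurableSpace E] [BorelSpace E] (μ : Measure E) [μ.IsAddHaarMeasure]

/-- A measurable set meeting every line through the origin in a null set is a null set. -/
theorem addHaar_eq_zero_of_forall_volume_smul_mem_eq_zero {s : Set E} (hs : MeasurableSet s)
    (h : ∀ w : E, volume {t : ℝ | t • w ∈ s} = 0) : μ s = 0 := by
  have hm : MeasurableSet {p : E × ℝ | p.2 • p.1 ∈ s} :=
    (measurable_snd.smul measurable_fst) hs
  have hprod : (μ.prod (volume : Measure ℝ)) {p : E × ℝ | p.2 • p.1 ∈ s} = 0 :=
    (Measure.measure_prod_null hm).2 (Eventually.of_forall h)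
  have hm' : MeasurableSet {p : ℝ × E | p.1 • p.2 ∈ s} :=
    (measurable_fst.smul measurable_snd) hs
  have hswap : ((volume : Measure ℝ).prod μ) {p : ℝ × E | p.1 • p.2 ∈ s} = 0 := by
    rw [← Measure.prod_swap, Measure.map_apply measurable_swap hm']
    exact hprod
  have hae : ∀ᵐ t : ℝ, μ ((t • ·) ⁻¹' s) = 0 :=
    (Measure.measure_prod_null hm').1 hswap
  obtain ⟨t, ht, ht0⟩ := (hae.and (Measure.ae_ne volume (0 : ℝ))).exists
  rw [Measure.addHaar_preimage_smul μ ht0] at ht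
  refine (mul_eq_zero.1 ht).resolve_left ?_
  simpa using pow_pos (abs_pos.2 ht0) _

/-- The zero set of a function analytic on a ball and nonzero at its center is a null set. -/
theorem AnalyticOnNhd.addHaar_ball_inter_zeros_eq_zero {f : E → ℝ} {z : E} {r : ℝ}
    (hf : AnalyticOnNhd ℝ f (ball z r)) (hz : f z ≠ 0) :
    μ (ball z r ∩ f ⁻¹' {0}) = 0 := by
  rcases le_or_gt r 0 with hr | hr
  · simp [ball_eq_empty.2 hr]
  have hmeas : MeasurableSet (ball z r ∩ f ⁻¹' {0}) := by
    have ho : IsOpen (ball z r ∩ f ⁻¹' {0}ᶜ) :=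
      hf.continuousOn.isOpen_inter_preimage isOpen_ball isOpen_compl_singleton
    have heq : ball z r ∩ f ⁻¹' {0} = ball z r \ (ball z r ∩ f ⁻¹' {0}ᶜ) := by
      ext x
      simp +contextual
    exact heq ▸ measurableSet_ball.diff ho.measurableSet
  rw [← measure_preimage_add μ z]
  refine addHaar_eq_zero_of_forall_volume_smul_mem_eq_zero μ (measurable_const_add z hmeas)
    fun w ↦ ?_
  let ℓ : ℝ → E := fun t ↦ z + t • w
  let V : Set ℝ := ℓ ⁻¹' ball z r
  have hℓ : AnalyticOnNhd ℝ ℓ V := fun t _ ↦ by fun_prop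
  have hVo : IsOpen V := isOpen_ball.preimage (by fun_prop)
  have h0 : (0 : ℝ) ∈ V := by simpa [V, ℓ] using hr
  have hV : IsConnected V := by
    refine ⟨⟨0, h0⟩, Convex.isPreconnected ?_⟩
    have := ((convex_ball z r).translate_preimage_right z).linear_preimage
      (LinearMap.toSpanSingleton ℝ E w)
    exact this
  have hcod := (hf.comp hℓ fun _ ht ↦ ht).preimage_zero_mem_codiscreteWithin
    (x := 0) (by simpa [ℓ] using hz) h0 hV
  have hae := ae_restrict_le_codiscreteWithin (μ := volume) hVo.measurableSet hcod
  rw [mem_ae_iff, Measure.restrict_apply₀' hVo.measurableSet.nullMeasurableSet] at hae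
  refine measure_mono_null ?_ hae
  rintro t ⟨ht, ht0⟩
  exact ⟨by simpa [ℓ] using ht0, ht⟩

/-- The zero set of a nonzero analytic function on a connected open set is a null set. -/
theorem AnalyticOnNhd.addHaar_inter_zeros_eq_zero {f : E → ℝ} {U : Set E}
    (hf : AnalyticOnNhd ℝ f U) (hUo : IsOpen U) (hU : IsPreconnected U)
    (hne : ∃ x ∈ U, f x ≠ 0) : μ (U ∩ f ⁻¹' {0}) = 0 := by
  refine measure_null_of_locally_null _ fun x hx ↦ ?_
  obtain ⟨r, hr, hrU⟩ := Metric.isOpen_iff.1 hUo x hx.1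
  have hfreq : ∃ᶠ z in 𝓝 x, f z ≠ 0 := by
    intro h
    obtain ⟨u, hu, hfu⟩ := hne
    refine hfu (hf.eqOn_zero_of_preconnected_of_eventuallyEq_zero hU hx.1 ?_ hu)
    filter_upwards [h] with z hz using not_not.1 hz
  obtain ⟨z, hz, hzx⟩ := (hfreq.and_eventually (ball_mem_nhds x (half_pos hr))).exists
  have hsub : ball z (r / 2) ⊆ U :=
    (ball_subset_ball' (by linarith [mem_ball.1 hzx])).trans hrU
  refine ⟨_, ?_, (hf.mono hsub).addHaar_ball_inter_zeros_eq_zero μ hz⟩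
  refine inter_mem ?_ (mem_of_superset self_mem_nhdsWithin inter_subset_right)
  exact mem_nhdsWithin_of_mem_nhds (isOpen_ball.mem_nhds (mem_ball_comm.1 hzx))

theorem isAddHaarMeasure_hausdorffMeasure_of_finrank_eq {n : ℕ} (hn : finrank ℝ E = n) :
    (μH[(n : ℝ)] : Measure E).IsAddHaarMeasure := by
  subst hn
  infer_instance

end NullSets

theorem LocallyLipschitz.hausdorffMeasure_image_eq_zero {X Y : Type*} [MetricSpace X]
    [MetricSpace Y] [SecondCountableTopology X] [MeasurableSpace X] [BorelSpace X]
    [MeasurableSpace Y] [BorelSpace Y] {f : X → Y} (hf : LocallyLipschitz f) {d : ℝ} (hd : 0 ≤ d)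
    {s : Set X} (hs : μH[d] s = 0) : μH[d] (f '' s) = 0 := by
  choose K t ht hK using hf
  obtain ⟨c, hc, hcov⟩ := TopologicalSpace.countable_cover_nhds ht
  have hsub : f '' s ⊆ ⋃ x ∈ c, f '' (s ∩ t x) := by
    rintro _ ⟨x, hx, rfl⟩
    obtain ⟨i, hi, hxi⟩ := mem_iUnion₂.1 (hcov.symm ▸ mem_univ x)
    exact mem_iUnion₂.2 ⟨i, hi, x, ⟨hx, hxi⟩, rfl⟩
  refine measure_mono_null hsub ((measure_biUnion_null_iff hc).2 fun i _ ↦ ?_)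
  refine le_antisymm ((((hK i).mono inter_subset_right).hausdorffMeasure_image_le hd).trans ?_)
    zero_le
  rw [measure_mono_null inter_subset_left hs, mul_zero]

section Sphere

variable {n : ℕ}

theorem continuous_gcDist_left (y : EuclideanSpace ℝ (Fin (n + 1))) :
    Continuous fun x ↦ gcDist x y :=
  Real.continuous_arccos.comp (by fun_prop)

/-- The distance to `y` is analytic away from `y` and its antipode. -/
theorem contDiffAt_gcDist_left {x y : EuclideanSpace ℝ (Fin (n + 1))} (hx : ‖x‖ = 1)
    (hy : ‖y‖ = 1) (h₁ : x ≠ y) (h₂ : x ≠ -y) {k : WithTop ℕ∞} :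
    ContDiffAt ℝ k (fun x ↦ gcDist x y) x := by
  refine ContDiffAt.comp x (Real.contDiffAt_arccos ?_ ?_)
    (contDiffAt_id.inner ℝ contDiffAt_const)
  · exact fun h ↦ h₂ ((inner_eq_neg_one_iff_of_norm_eq_one hx hy).1 h)
  · exact fun h ↦ h₁ ((inner_eq_one_iff_of_norm_eq_one hx hy).1 h)

/-- A combination of distance functions with a nonzero coefficient at `y i` does not vanish
identically near `y i` on the sphere, since the distance to `y i` has a corner there. -/
theorem not_eventually_sum_gcDist_eq_zero (hn : 1 ≤ n) {m : ℕ}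
    {y : Fin m → EuclideanSpace ℝ (Fin (n + 1))} (hmem : ∀ j, ‖y j‖ = 1)
    (hdist : Function.Injective y) (hant : ∀ i j, y i ≠ -y j) (c₀ : ℝ) {c : Fin m → ℝ}
    {i : Fin m} (hi : c i ≠ 0) :
    ¬ ∀ᶠ x in 𝓝 (y i), ‖x‖ = 1 → c₀ + ∑ j, c j * gcDist x (y j) = 0 := by
  intro h
  obtain ⟨e, he, hye⟩ : ∃ e : EuclideanSpace ℝ (Fin (n + 1)), ‖e‖ = 1 ∧ inner ℝ (y i) e = 0 := by
    have : Nontrivial (ℝ ∙ y i)ᗮ := by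
      have : Fact (finrank ℝ (EuclideanSpace ℝ (Fin (n + 1))) = n + 1) := ⟨by simp⟩
      refine Module.nontrivial_of_finrank_pos (R := ℝ) ?_
      rw [Submodule.finrank_orthogonal_span_singleton (n := n)
        (norm_ne_zero_iff.1 (by simp [hmem i]))]
      omega
    obtain ⟨e, he⟩ := exists_norm_eq (ℝ ∙ y i)ᗮ zero_le_one
    exact ⟨e, he, Submodule.mem_orthogonal_singleton_iff_inner_right.1 e.2⟩
  let γ : ℝ → EuclideanSpace ℝ (Fin (n + 1)) := fun t ↦ Real.cos t • y i + Real.sin t • e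
  have hγ0 : γ 0 = y i := by simp [γ]
  have hγd : Differentiable ℝ γ := by
    intro t
    fun_prop
  have hγ1 (t : ℝ) : ‖γ t‖ = 1 := by
    have : ‖γ t‖ ^ 2 = 1 := by
      simp [γ, norm_add_sq_real, norm_smul, inner_smul_left, inner_smul_right, hye, he, hmem i]
    exact (pow_eq_one_iff_of_nonneg (norm_nonneg _) two_ne_zero).1 this
  have habs : ∀ᶠ t in 𝓝 (0 : ℝ), gcDist (γ t) (y i) = |t| := by
    filter_upwards [Icc_mem_nhds (neg_lt_zero.2 Real.pi_pos) Real.pi_pos] with t ht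
    have : inner ℝ (γ t) (y i) = Real.cos |t| := by
      simp [γ, inner_add_left, inner_smul_left, real_inner_comm (y i) e, hye, hmem i]
    rw [gcDist, this, Real.arccos_cos (abs_nonneg t) (abs_le.2 ht)]
  have hdiff : DifferentiableAt ℝ
      (fun t ↦ -(c i)⁻¹ * (c₀ + ∑ j ∈ Finset.univ.erase i, c j * gcDist (γ t) (y j))) 0 := by
    refine (DifferentiableAt.const_add _ (DifferentiableAt.fun_sum fun j hj ↦ ?_)).const_mul _
    refine DifferentiableAt.const_mul ?_ _
    have hji : j ≠ i := (Finset.mem_erase.1 hj).1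
    have hd : DifferentiableAt ℝ (fun x ↦ gcDist x (y j)) (γ 0) := by
      rw [hγ0]
      exact (contDiffAt_gcDist_left (hmem i) (hmem j) (fun h ↦ hji (hdist h.symm)) (hant i j)
        (k := 1)).differentiableAt one_ne_zero
    exact hd.comp 0 (hγd 0)
  refine not_differentiableAt_abs_zero (hdiff.congr_of_eventuallyEq ?_)
  have hev := hγd.continuous.continuousAt.tendsto.eventually (hγ0.symm ▸ h)
  filter_upwards [habs, hev] with t ht hzero
  have := hzero (hγ1 t)
  rw [← Finset.add_sum_erase _ _ (Finset.mem_univ i), ht] at this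
  field_simp
  linarith

end Sphere

theorem stmt_9 (n : ℕ) (hn : 2 ≤ n) (m : ℕ)
    (y : Fin m → EuclideanSpace ℝ (Fin (n + 1)))
    (hmem : ∀ j, y j ∈ unitSphere n)
    (hdist : Function.Injective y)
    (hant : ∀ i j, y i ≠ -y j)
    (c₀ : ℝ) (c : Fin m → ℝ) (hc : c ≠ 0) :
    sphereMeasure n {x | c₀ + ∑ j, c j * gcDist x (y j) = 0} = 0 := by
  have hnorm (j : Fin m) : ‖y j‖ = 1 := mem_sphere_zero_iff_norm.1 (hmem j)
  obtain ⟨i, hi⟩ := Function.ne_iff.1 hc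
  let E := EuclideanSpace ℝ (Fin (n + 1))
  let v : E := -y i
  have hv : ‖v‖ = 1 := by simp [v, hnorm]
  have : Fact (finrank ℝ E = n + 1) := ⟨by simp [E]⟩
  let W := (ℝ ∙ v)ᗮ
  have hW : finrank ℝ W = n :=
    Submodule.finrank_orthogonal_span_singleton (norm_ne_zero_iff.1 (by simp [hv]))
  have hrank : 1 < Module.rank ℝ W := by
    rw [← finrank_eq_rank, hW]
    exact_mod_cast hn
  have : Nontrivial W := Module.nontrivial_of_finrank_pos (R := ℝ) (by omega)
  let φ : W → E := fun w ↦ stereoInvFunAux v w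
  have hφ : ContDiff ℝ ⊤ φ := contDiff_stereoInvFunAux.comp W.subtypeL.contDiff
  have hφ1 (w : W) : ‖φ w‖ = 1 := mem_sphere_zero_iff_norm.1 (stereoInvFunAux_mem hv w.2)
  have hφinj : Function.Injective φ := fun w w' h ↦ by
    rw [← stereo_right_inv hv w, ← stereo_right_inv hv w']
    exact congrArg (stereoToFun v) h
  have hφsurj {x : E} (hx : ‖x‖ = 1) (hxv : x ≠ v) : x ∈ range φ :=
    ⟨_, congrArg Subtype.val (stereo_left_inv hv (x := ⟨x, mem_sphere_zero_iff_norm.2 hx⟩) hxv)⟩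
  let f : E → ℝ := fun x ↦ c₀ + ∑ j, c j * gcDist x (y j)
  have hf : Continuous f := continuous_const.add
    (continuous_finsetSum _ fun j _ ↦ (continuous_gcDist_left (y j)).const_mul (c j))
  let T : Set W := φ ⁻¹' (range y ∪ range fun j ↦ -y j)
  have hT : T.Finite := ((finite_range y).union (finite_range _)).preimage hφinj.injOn
  have hana : AnalyticOnNhd ℝ (f ∘ φ) Tᶜ := fun w hw ↦ by
    refine ContDiffAt.analyticAt ?_
    refine ContDiffAt.comp w (contDiffAt_const.add (ContDiffAt.sum fun j _ ↦
      contDiffAt_const.mul (contDiffAt_gcDist_left (hφ1 w) (hnorm j) ?_ ?_))) hφ.contDiffAt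
    · exact fun h ↦ hw (Or.inl ⟨j, h.symm⟩)
    · exact fun h ↦ hw (Or.inr ⟨j, h.symm⟩)
  have hne : ∃ w ∈ Tᶜ, (f ∘ φ) w ≠ 0 := by
    by_contra! hzero
    have hall : f ∘ φ = 0 := (hf.comp hφ.continuous).ext_on (hT.countable.dense_compl ℝ)
      continuous_const fun w hw ↦ hzero w hw
    refine not_eventually_sum_gcDist_eq_zero (by omega) hnorm hdist hant c₀ hi ?_
    filter_upwards [isOpen_ne.mem_nhds (hant i i)] with x hxv hx
    obtain ⟨w, rfl⟩ := hφsurj hx hxv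
    exact congrFun hall w
  have hHaar : (μH[(n : ℝ)] : Measure W).IsAddHaarMeasure :=
    isAddHaarMeasure_hausdorffMeasure_of_finrank_eq hW
  have hnull : μH[(n : ℝ)] (Tᶜ ∩ (f ∘ φ) ⁻¹' {0}) = 0 :=
    hana.addHaar_inter_zeros_eq_zero _ hT.isClosed.isOpen_compl
      (hT.countable.isConnected_compl_of_one_lt_rank hrank).isPreconnected hne
  have himage := (hφ.of_le le_top : ContDiff ℝ 1 φ).locallyLipschitz.hausdorffMeasure_image_eq_zero
    n.cast_nonneg hnull
  have : NullSingletonClass (μH[(n : ℝ)] : Measure E) :=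
    Measure.nullSingletonClass_hausdorff E (by positivity)
  have hfin : μH[(n : ℝ)] (insert v (φ '' T)) = 0 :=
    ((hT.image φ).insert v).measure_zero _
  have hmeas : MeasurableSet {x | f x = 0} := (isClosed_singleton.preimage hf).measurableSet
  refine (Measure.restrict_apply hmeas).trans ?_
  refine measure_mono_null ?_ (measure_union_null himage hfin)
  rintro x ⟨hx0, hx⟩
  by_cases hxv : x = v
  · exact Or.inr (Or.inl hxv)
  obtain ⟨w, rfl⟩ := hφsurj (mem_sphere_zero_iff_norm.1 hx) hxv
  by_cases hw : w ∈ T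
  · exact Or.inr (Or.inr ⟨w, hw, rfl⟩)
  · exact Or.inl ⟨w, ⟨hw, hx0⟩, rfl⟩
end

section
/- (Ingham) Let δ > 0 and set m = ⌈δ⌉ + 2. Then there exist real constants c_1, …, c_m and C > 0 such that for all k ∈ ℕ, | A_k^δ − Σ_{j=1}^{m} c_j · (k + j/m)^δ | ≤ C · (k+1)^{-2}, where A_k^δ = Γ(k+δ+1)/(Γ(k+1)·Γ(δ+1)). -/
/-- The generalized binomial coefficient `A_k^δ = Γ(k+δ+1)/(Γ(k+1)·Γ(δ+1))`. -/
noncomputable def cesaroA (δ : ℝ) (k : ℕ) : ℝ :=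
  Real.Gamma ((k : ℝ) + δ + 1) / (Real.Gamma ((k : ℝ) + 1) * Real.Gamma (δ + 1))

open Filter Topology Asymptotics Polynomial

/-- Taylor expansion of the real power `(1 + s y) ^ δ` at `y = 0`. -/
lemma one_add_mul_rpow_sub_sum_isBigO (δ s : ℝ) (n : ℕ) :
    (fun y : ℝ => (1 + s * y) ^ δ - ∑ i ∈ Finset.range n, Ring.choose δ i * (s * y) ^ i)
      =O[𝓝 0] fun y => y ^ n := by
  have h := (Real.one_add_rpow_hasFPowerSeriesAt_zero (a := δ)).isBigO_sub_partialSum_pow n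
  have hs : Tendsto (fun y : ℝ => s * y) (𝓝 0) (𝓝 0) := by
    simpa using (continuous_const_mul s).tendsto 0
  have h2 := h.comp_tendsto hs
  refine (h2.congr_left ?_).trans ?_
  · intro y
    simp [FormalMultilinearSeries.partialSum, -FormalMultilinearSeries.apply_eq_prod_smul_coeff]
  · refine IsBigO.of_bound (|s| ^ n) (Eventually.of_forall fun y => ?_)
    simp [mul_pow]

lemma succ_mul_ringChoose_succ (δ : ℝ) (i : ℕ) :
    ((i : ℝ) + 1) * Ring.choose δ (i + 1) = (δ - i) * Ring.choose δ i := by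
  have h1 := Ring.descPochhammer_eq_factorial_smul_choose δ (i + 1)
  have h0 := Ring.descPochhammer_eq_factorial_smul_choose δ i
  rw [descPochhammer_succ_right, Polynomial.smeval_mul, h0] at h1
  simp only [Polynomial.smeval_sub, Polynomial.smeval_X, Polynomial.smeval_natCast, nsmul_eq_mul,
    pow_one, pow_zero, mul_one, Nat.factorial_succ, Nat.cast_mul, Nat.cast_succ] at h1
  have hf : ((i.factorial : ℕ) : ℝ) ≠ 0 := by exact_mod_cast i.factorial_ne_zero
  apply mul_left_cancel₀ hf
  linear_combination -h1

/-- The polynomial in `t` whose multiple by `Ring.choose δ i` is the coefficient of `y ^ (i + 1)` in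
`(1 + t y) ^ δ - (1 + δ y) (1 + (t - 1) y) ^ δ`. -/
noncomputable def defectPoly (δ : ℝ) (i : ℕ) : ℝ[X] :=
  C ((δ - i) / (i + 1)) * ∑ l ∈ Finset.range (i + 1), X ^ l * (X - 1) ^ (i - l) -
    C δ * (X - 1) ^ i

lemma natDegree_X_sub_one_pow_le (i : ℕ) : ((X - 1 : ℝ[X]) ^ i).natDegree ≤ i := by
  rw [← C_1, natDegree_pow, natDegree_X_sub_C, mul_one]

lemma coeff_X_sub_one_pow_self (i : ℕ) : ((X - 1 : ℝ[X]) ^ i).coeff i = 1 := by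
  have h := ((monic_X_sub_C (1 : ℝ)).pow i).coeff_natDegree
  rwa [natDegree_pow, natDegree_X_sub_C, mul_one, C_1] at h

lemma natDegree_defectPoly_le (δ : ℝ) (i : ℕ) : (defectPoly δ i).natDegree ≤ i := by
  refine (natDegree_sub_le _ _).trans (max_le ((natDegree_C_mul_le _ _).trans ?_)
    ((natDegree_C_mul_le _ _).trans (natDegree_X_sub_one_pow_le i)))
  refine natDegree_sum_le_of_forall_le _ _ fun l hl => ?_
  have hl' : l ≤ i := by simpa [Nat.lt_succ_iff] using hl
  refine natDegree_mul_le.trans ?_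
  have := natDegree_X_sub_one_pow_le (i - l)
  simp only [natDegree_X_pow]
  omega

lemma coeff_defectPoly_self (δ : ℝ) (i : ℕ) : (defectPoly δ i).coeff i = -i := by
  have h : ∀ l ∈ Finset.range (i + 1), ((X : ℝ[X]) ^ l * (X - 1) ^ (i - l)).coeff i = 1 := by
    intro l hl
    have hl' : l ≤ i := by simpa [Nat.lt_succ_iff] using hl
    rw [coeff_X_pow_mul', if_pos hl', coeff_X_sub_one_pow_self]
  rw [defectPoly, coeff_sub, coeff_C_mul, coeff_C_mul, finsetSum_coeff, Finset.sum_congr rfl h,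
    coeff_X_sub_one_pow_self]
  simp only [Finset.sum_const, Finset.card_range, nsmul_eq_mul, Nat.cast_add, Nat.cast_one]
  field_simp
  ring

lemma ringChoose_mul_eval_defectPoly (δ t : ℝ) (i : ℕ) :
    Ring.choose δ i * (defectPoly δ i).eval t =
      Ring.choose δ (i + 1) * (t ^ (i + 1) - (t - 1) ^ (i + 1)) -
        δ * Ring.choose δ i * (t - 1) ^ i := by
  have hg := geom_sum₂_mul t (t - 1) (i + 1)
  simp only [sub_sub_cancel, mul_one, Nat.add_sub_cancel] at hg
  have hc := succ_mul_ringChoose_succ δ i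
  have hi : (i : ℝ) + 1 ≠ 0 := by positivity
  rw [← hg]
  simp only [defectPoly, eval_sub, eval_mul, eval_C, eval_finsetSum, eval_pow, eval_X, eval_one]
  have : Ring.choose δ (i + 1) = (δ - i) / (i + 1) * Ring.choose δ i := by
    field_simp
    linear_combination hc
  rw [this]
  ring

lemma exists_weights_defectPoly (δ : ℝ) {m : ℕ} (hm : 0 < m) (t : Fin m → ℝ)
    (ht : Function.Injective t) :
    ∃ c : Fin m → ℝ, ∑ j, c j = 1 ∧
      ∀ i < m, ∑ j, c j * (defectPoly δ i).eval (t j) = 0 := by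
  let p : Fin m → ℝ[X] := fun i =>
    if (i : ℕ) = 0 then 1 else C (-(1 / (i : ℕ) : ℝ)) * defectPoly δ i
  have hle : ∀ i, (p i).natDegree ≤ i := by
    intro i
    by_cases hi : (i : ℕ) = 0
    · simp [p, hi]
    · simp only [p, hi, if_false]
      exact (natDegree_C_mul_le _ _).trans (natDegree_defectPoly_le δ i)
  have hcoeff : ∀ i, (p i).coeff i = 1 := by
    intro i
    by_cases hi : (i : ℕ) = 0
    · simp [p, hi]
    · have hi' : ((i : ℕ) : ℝ) ≠ 0 := by exact_mod_cast hi
      simp only [p, hi, if_false, coeff_C_mul, coeff_defectPoly_self]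
      field_simp
  have hdet : (Matrix.of fun i j => (p j).eval (t i)).det ≠ 0 := by
    rw [← Matrix.det_eval_matrixOfPolynomials_eq_det_vandermonde t p
      (fun i => natDegree_eq_of_le_of_coeff_ne_zero (hle i) (by simp [hcoeff i]))
      (fun i => monic_of_natDegree_le_of_coeff_eq_one _ (hle i) (hcoeff i))]
    exact Matrix.det_vandermonde_ne_zero_iff.2 ht
  obtain ⟨c, hc⟩ := Matrix.vecMul_surjective_iff_isUnit.2
    ((Matrix.isUnit_iff_isUnit_det _).2 (isUnit_iff_ne_zero.2 hdet)) (Pi.single ⟨0, hm⟩ 1)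
  have hc' : ∀ i : Fin m, ∑ j, c j * (p i).eval (t j) = Pi.single (M := fun _ => ℝ) ⟨0, hm⟩ 1 i :=
    fun i => congrFun hc i
  refine ⟨c, ?_, fun i hi => ?_⟩
  · simpa [p] using hc' ⟨0, hm⟩
  · rcases Nat.eq_zero_or_pos i with rfl | hpos
    · simp [defectPoly]
    · have h := hc' ⟨i, hi⟩
      have hne : (⟨i, hi⟩ : Fin m) ≠ ⟨0, hm⟩ := by simp [hpos.ne']
      have hi' : (i : ℝ) ≠ 0 := by exact_mod_cast hpos.ne'
      simp only [p, hpos.ne', if_false, eval_mul, eval_C, Pi.single_eq_of_ne hne,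
        mul_left_comm (c _), ← Finset.mul_sum] at h
      exact (mul_eq_zero.1 h).resolve_left (by simpa using hi')

/-- Weighted defect of the functions `(k + t j) ^ δ` in the recursion satisfied by `cesaroA δ`,
in the variable `y = 1 / (k + 1)`. -/
noncomputable def recursionDefect (δ : ℝ) {m : ℕ} (c t : Fin m → ℝ) (y : ℝ) : ℝ :=
  ∑ j, c j * ((1 + t j * y) ^ δ - (1 + δ * y) * (1 + (t j - 1) * y) ^ δ)

lemma truncated_defect_eq (δ t y : ℝ) (m : ℕ) :
    ∑ i ∈ Finset.range (m + 1), Ring.choose δ i * (t * y) ^ i -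
        (1 + δ * y) * ∑ i ∈ Finset.range (m + 1), Ring.choose δ i * ((t - 1) * y) ^ i =
      (∑ i ∈ Finset.range m, Ring.choose δ i * (defectPoly δ i).eval t * y ^ (i + 1)) -
        δ * Ring.choose δ m * (t - 1) ^ m * y ^ (m + 1) := by
  induction m with
  | zero => simp
  | succ m ih =>
    rw [Finset.sum_range_succ _ (m + 1), Finset.sum_range_succ _ (m + 1),
      Finset.sum_range_succ (fun i => Ring.choose δ i * (defectPoly δ i).eval t * y ^ (i + 1)) m,
      ringChoose_mul_eval_defectPoly]
    simp only [mul_pow] at ih ⊢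
    linear_combination ih

lemma recursionDefect_isBigO (δ : ℝ) {m : ℕ} (c t : Fin m → ℝ)
    (hc : ∀ i < m, ∑ j, c j * (defectPoly δ i).eval (t j) = 0) :
    recursionDefect δ c t =O[𝓝 0] fun y => y ^ (m + 1) := by
  let T : ℝ → ℝ → ℝ := fun s y => ∑ i ∈ Finset.range (m + 1), Ring.choose δ i * (s * y) ^ i
  have hT : ∀ s, (fun y : ℝ => (1 + s * y) ^ δ - T s y) =O[𝓝 0] fun y => y ^ (m + 1) :=
    fun s => one_add_mul_rpow_sub_sum_isBigO δ s (m + 1)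
  have hb : (fun y : ℝ => 1 + δ * y) =O[𝓝 0] fun _ => (1 : ℝ) :=
    (by fun_prop : Continuous fun y : ℝ => 1 + δ * y).tendsto 0 |>.isBigO_one ℝ
  have h1 : (fun y : ℝ => ∑ j, c j * (((1 + t j * y) ^ δ - T (t j) y) -
      (1 + δ * y) * ((1 + (t j - 1) * y) ^ δ - T (t j - 1) y))) =O[𝓝 0] fun y => y ^ (m + 1) := by
    refine IsBigO.fun_sum fun j _ => ?_
    refine ((hT (t j)).sub ?_).const_mul_left (c j)
    simpa using hb.mul (hT (t j - 1))
  have h2 : (fun y : ℝ => (-∑ j, c j * (δ * Ring.choose δ m * (t j - 1) ^ m)) * y ^ (m + 1))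
      =O[𝓝 0] fun y => y ^ (m + 1) := (isBigO_refl _ _).const_mul_left _
  refine (h1.add h2).congr_left fun y => ?_
  have h3 : ∑ j, c j * (T (t j) y - (1 + δ * y) * T (t j - 1) y) =
      (-∑ j, c j * (δ * Ring.choose δ m * (t j - 1) ^ m)) * y ^ (m + 1) := by
    simp only [T, truncated_defect_eq]
    simp only [mul_sub, Finset.sum_sub_distrib, Finset.mul_sum]
    rw [Finset.sum_comm, Finset.sum_eq_zero, neg_mul, Finset.sum_mul, zero_sub]
    · simp only [mul_assoc]
    · intro i hi
      have h := hc i (Finset.mem_range.1 hi)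
      calc _ = Ring.choose δ i * y ^ (i + 1) * ∑ j, c j * (defectPoly δ i).eval (t j) := by
            rw [Finset.mul_sum]; exact Finset.sum_congr rfl fun j _ => by ring
        _ = 0 := by rw [h, mul_zero]
  rw [← h3, recursionDefect, ← Finset.sum_add_distrib]
  exact Finset.sum_congr rfl fun j _ => by ring

lemma cesaroA_pos {δ : ℝ} (hδ : 0 < δ) (k : ℕ) : 0 < cesaroA δ k :=
  div_pos (Real.Gamma_pos_of_pos (by positivity))
    (mul_pos (Real.Gamma_pos_of_pos (by positivity)) (Real.Gamma_pos_of_pos (by positivity)))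

lemma cesaroA_zero {δ : ℝ} (hδ : 0 < δ) : cesaroA δ 0 = 1 := by
  have := (Real.Gamma_pos_of_pos (by positivity : 0 < δ + 1)).ne'
  simp [cesaroA, this]

lemma succ_mul_cesaroA_succ {δ : ℝ} (hδ : 0 < δ) (k : ℕ) :
    ((k : ℝ) + 1) * cesaroA δ (k + 1) = (k + 1 + δ) * cesaroA δ k := by
  have h1 := (Real.Gamma_pos_of_pos (by positivity : 0 < δ + 1)).ne'
  have h2 := (Real.Gamma_pos_of_pos (by positivity : 0 < (k : ℝ) + 1)).ne'
  have h3 : (k : ℝ) + 1 ≠ 0 := by positivity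
  have e1 : Real.Gamma (((k + 1 : ℕ) : ℝ) + δ + 1) =
      (k + 1 + δ) * Real.Gamma ((k : ℝ) + δ + 1) := by
    rw [Real.Gamma_add_one (by positivity)]
    push_cast
    rw [add_right_comm (k : ℝ) 1 δ]
  have e2 : Real.Gamma (((k + 1 : ℕ) : ℝ) + 1) = (k + 1) * Real.Gamma ((k : ℝ) + 1) := by
    rw [Real.Gamma_add_one (by positivity)]
    push_cast
    rfl
  rw [cesaroA, cesaroA, e1, e2]
  field_simp

lemma factorial_mul_cesaroA {δ : ℝ} (hδ : 0 < δ) (n : ℕ) :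
    (n.factorial : ℝ) * cesaroA δ n = ∏ j ∈ Finset.range n, (δ + 1 + j) := by
  induction n with
  | zero => simp [cesaroA_zero hδ]
  | succ n ih =>
    rw [Finset.prod_range_succ, ← ih, Nat.factorial_succ]
    push_cast
    linear_combination (n.factorial : ℝ) * succ_mul_cesaroA_succ hδ n

lemma tendsto_rpow_div_cesaroA {δ : ℝ} (hδ : 0 < δ) :
    Tendsto (fun n : ℕ => (n : ℝ) ^ δ / cesaroA δ n) atTop (𝓝 (Real.Gamma (δ + 1))) := by
  have h1 : Tendsto (fun n : ℕ => 1 + (δ + 1) / (n : ℝ)) atTop (𝓝 1) := by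
    simpa using (tendsto_const_div_atTop_nhds_zero_nat (δ + 1)).const_add 1
  have h := (Real.GammaSeq_tendsto_Gamma (δ + 1)).mul h1
  rw [mul_one] at h
  refine h.congr' ?_
  filter_upwards [eventually_gt_atTop 0] with n hn
  have hn' : (0 : ℝ) < n := by exact_mod_cast hn
  have hA := (cesaroA_pos hδ n).ne'
  have hf : (n.factorial : ℝ) ≠ 0 := by exact_mod_cast n.factorial_ne_zero
  have hd : δ + 1 + n ≠ 0 := by positivity
  rw [Real.GammaSeq, Finset.prod_range_succ, ← factorial_mul_cesaroA hδ,
    Real.rpow_add_one hn'.ne']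
  field_simp
  ring

lemma tendsto_succ_rpow_div_cesaroA_succ {δ : ℝ} (hδ : 0 < δ) :
    Tendsto (fun n : ℕ => ((n : ℝ) + 1) ^ δ / cesaroA δ (n + 1)) atTop
      (𝓝 (Real.Gamma (δ + 1))) := by
  simpa [Function.comp_def] using (tendsto_rpow_div_cesaroA hδ).comp (tendsto_add_atTop_nat 1)

lemma tendsto_succ_rpow_div_cesaroA {δ : ℝ} (hδ : 0 < δ) :
    Tendsto (fun n : ℕ => ((n : ℝ) + 1) ^ δ / cesaroA δ n) atTop (𝓝 (Real.Gamma (δ + 1))) := by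
  have h1 : Tendsto (fun n : ℕ => 1 + δ * (1 / ((n : ℝ) + 1))) atTop (𝓝 1) := by
    simpa using (tendsto_one_div_add_atTop_nhds_zero_nat (𝕜 := ℝ)).const_mul δ |>.const_add 1
  have h := (tendsto_succ_rpow_div_cesaroA_succ hδ).mul h1
  rw [mul_one] at h
  refine h.congr fun n => ?_
  have hA := (cesaroA_pos hδ n).ne'
  have hA' := (cesaroA_pos hδ (n + 1)).ne'
  have hn : (n : ℝ) + 1 ≠ 0 := by positivity
  field_simp
  linear_combination -succ_mul_cesaroA_succ hδ n

lemma add_rpow_eq_succ_rpow_mul {δ t : ℝ} (ht : 0 ≤ t) (k : ℕ) :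
    ((k : ℝ) + t) ^ δ = ((k : ℝ) + 1) ^ δ * (1 + (t - 1) * (1 / ((k : ℝ) + 1))) ^ δ := by
  have hk : (0 : ℝ) < (k : ℝ) + 1 := by positivity
  have e : 1 + (t - 1) * (1 / ((k : ℝ) + 1)) = (k + t) / (k + 1) := by
    field_simp
    ring
  rw [e, ← Real.mul_rpow hk.le (by positivity), mul_div_cancel₀ _ hk.ne']

/-- A convergent sequence whose increments are `O((n + 1)⁻¹ ^ (m + 1))` converges at the rate
`O((n + 1)⁻¹ ^ m)`. -/
lemma exists_abs_sub_le_of_increment_le {u : ℕ → ℝ} {l C : ℝ} {m : ℕ} (hm : 0 < m) (hC : 0 ≤ C)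
    (hu : Tendsto u atTop (𝓝 l))
    (h : ∀ n : ℕ, |u (n + 1) - u n| ≤ C * (1 / ((n : ℝ) + 1)) ^ (m + 1)) (n : ℕ) :
    |u n - l| ≤ 2 * C * (1 / ((n : ℝ) + 1)) ^ m := by
  let y : ℕ → ℝ := fun n => (1 / ((n : ℝ) + 1)) ^ m
  have hy : Tendsto (fun n => 2 * C * y n) atTop (𝓝 0) := by
    simpa [y, hm.ne'] using
      ((tendsto_one_div_add_atTop_nhds_zero_nat (𝕜 := ℝ)).pow m).const_mul (2 * C)
  have hstep : ∀ n, |u (n + 1) - u n| ≤ 2 * C * y n - 2 * C * y (n + 1) := by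
    intro n
    refine (h n).trans ?_
    obtain ⟨q, rfl⟩ : ∃ q, m = q + 1 := ⟨m - 1, by omega⟩
    simp only [y]
    push_cast
    set a : ℝ := 1 / ((n : ℝ) + 1) with ha
    set b : ℝ := 1 / ((n : ℝ) + 1 + 1) with hb
    have ha0 : 0 < a := by positivity
    have hb0 : 0 < b := by positivity
    have hba : b ≤ a := by
      rw [ha, hb]
      gcongr
      linarith
    have hab : a - b = a * b := by
      rw [ha, hb]
      field_simp
      ring
    have h2 : a ≤ 2 * b := by
      have : a ≤ 1 := by
        rw [ha, div_le_one (by positivity)]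
        linarith [(Nat.cast_nonneg n : (0 : ℝ) ≤ n)]
      nlinarith
    have h3 : b ^ (q + 1) ≤ a ^ q * b := by
      rw [pow_succ]
      gcongr
    have h4 : a ^ (q + 1 + 1) ≤ 2 * (a ^ (q + 1) - b ^ (q + 1)) := by
      have e : a ^ (q + 1 + 1) ≤ a ^ q * (a * (2 * b)) := by
        rw [show a ^ (q + 1 + 1) = a ^ q * (a * a) by ring]
        gcongr
      have e2 : a ^ q * (a * b) = a ^ (q + 1) - a ^ q * b := by
        rw [← hab]
        ring
      nlinarith
    nlinarith
  have hup : Monotone fun n => u n - 2 * C * y n :=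
    monotone_nat_of_le_succ fun n => by linarith [neg_le_of_abs_le (hstep n)]
  have hdown : Antitone fun n => u n + 2 * C * y n :=
    antitone_nat_of_succ_le fun n => by linarith [le_of_abs_le (hstep n)]
  have h1 : u n - 2 * C * y n ≤ l := hup.ge_of_tendsto (by simpa using hu.sub hy) n
  have h2 : l ≤ u n + 2 * C * y n := hdown.le_of_tendsto (by simpa using hu.add hy) n
  rw [abs_le]
  constructor <;> simp only [y] at h1 h2 <;> linarith

/-- With suitable weights, `∑ j, c j * (k + t j) ^ δ` approximates `Γ(δ + 1) * cesaroA δ k`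
with relative error `O((k + 1)⁻¹ ^ m)`. -/
lemma exists_weights_relative_error {δ : ℝ} (hδ : 0 < δ) {m : ℕ} (hm : 0 < m) (t : Fin m → ℝ)
    (ht : Function.Injective t) (ht0 : ∀ j, 0 ≤ t j) :
    ∃ c : Fin m → ℝ, ∃ C : ℝ, 0 ≤ C ∧ ∀ k : ℕ,
      |(∑ j, c j * ((k : ℝ) + t j) ^ δ) / cesaroA δ k - Real.Gamma (δ + 1)| ≤
        C * (1 / ((k : ℝ) + 1)) ^ m := by
  obtain ⟨c, hc1, hc⟩ := exists_weights_defectPoly δ hm t ht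
  let y : ℕ → ℝ := fun k => 1 / ((k : ℝ) + 1)
  have hy : Tendsto y atTop (𝓝 0) := tendsto_one_div_add_atTop_nhds_zero_nat
  let u : ℕ → ℝ := fun k => (∑ j, c j * ((k : ℝ) + t j) ^ δ) / cesaroA δ k
  have hsum : ∀ k : ℕ, ∑ j, c j * ((k : ℝ) + t j) ^ δ =
      ((k : ℝ) + 1) ^ δ * ∑ j, c j * (1 + (t j - 1) * y k) ^ δ := by
    intro k
    rw [Finset.mul_sum]
    refine Finset.sum_congr rfl fun j _ => ?_
    rw [add_rpow_eq_succ_rpow_mul (ht0 j)]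
    ring
  have hu : Tendsto u atTop (𝓝 (Real.Gamma (δ + 1))) := by
    have h1 : Tendsto (fun k => ∑ j, c j * (1 + (t j - 1) * y k) ^ δ) atTop (𝓝 1) := by
      suffices h : Tendsto (fun k => ∑ j, c j * (1 + (t j - 1) * y k) ^ δ) atTop (𝓝 (∑ j, c j)) by
        rwa [hc1] at h
      refine tendsto_finsetSum _ fun j _ => ?_
      have h : Tendsto (fun k => (1 + (t j - 1) * y k) ^ δ) atTop
          (𝓝 ((1 + (t j - 1) * 0) ^ δ)) :=
        ((hy.const_mul (t j - 1)).const_add (1 : ℝ)).rpow_const (Or.inr hδ.le)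
      simpa using h.const_mul (c j)
    have h := (tendsto_succ_rpow_div_cesaroA hδ).mul h1
    rw [mul_one] at h
    refine h.congr fun k => ?_
    simp only [u, hsum]
    ring
  have hinc : ∀ k, u (k + 1) - u k =
      ((k : ℝ) + 1) ^ δ / cesaroA δ (k + 1) * recursionDefect δ c t (y k) := by
    intro k
    have hA := (cesaroA_pos hδ k).ne'
    have hA' := (cesaroA_pos hδ (k + 1)).ne'
    have hk : (k : ℝ) + 1 ≠ 0 := by positivity
    have e1 : ∑ j, c j * (((k + 1 : ℕ) : ℝ) + t j) ^ δ =
        ((k : ℝ) + 1) ^ δ * ∑ j, c j * (1 + t j * y k) ^ δ := by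
      rw [Finset.mul_sum]
      refine Finset.sum_congr rfl fun j _ => ?_
      have h := add_rpow_eq_succ_rpow_mul (δ := δ) (t := 1 + t j) (by linarith [ht0 j]) k
      rw [add_sub_cancel_left, ← add_assoc] at h
      push_cast
      rw [h]
      ring
    have e2 : recursionDefect δ c t (y k) = ∑ j, c j * (1 + t j * y k) ^ δ -
        (1 + δ * y k) * ∑ j, c j * (1 + (t j - 1) * y k) ^ δ := by
      rw [recursionDefect, Finset.mul_sum, ← Finset.sum_sub_distrib]
      exact Finset.sum_congr rfl fun j _ => by ring
    have e3 : cesaroA δ (k + 1) = (1 + δ * y k) * cesaroA δ k := by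
      simp only [y]
      field_simp
      linear_combination succ_mul_cesaroA_succ hδ k
    have e4 : 1 + δ * y k ≠ 0 := by positivity
    simp only [u]
    rw [e1, hsum, e2, e3]
    generalize ∑ j, c j * (1 + t j * y k) ^ δ = P
    generalize ∑ j, c j * (1 + (t j - 1) * y k) ^ δ = Q
    generalize 1 + δ * y k = z at e4 ⊢
    field_simp
  have hO : (fun k => u (k + 1) - u k) =O[atTop] fun k => y k ^ (m + 1) := by
    have h1 := (tendsto_succ_rpow_div_cesaroA_succ hδ).isBigO_one ℝ
    have h2 := (recursionDefect_isBigO δ c t hc).comp_tendsto hy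
    simpa [hinc, Function.comp_def] using h1.mul h2
  obtain ⟨C, hC⟩ := (isBigO_nat_atTop_iff (fun k h => by
    have : 0 < y k ^ (m + 1) := by positivity
    exact absurd h this.ne')).1 hO
  refine ⟨c, 2 * |C|, by positivity, fun k => exists_abs_sub_le_of_increment_le hm (abs_nonneg C)
    hu (fun n => (hC n).trans ?_) k⟩
  rw [Real.norm_of_nonneg (by positivity)]
  gcongr
  exact le_abs_self C

lemma exists_cesaroA_le {δ : ℝ} (hδ : 0 < δ) :
    ∃ B > 0, ∀ k : ℕ, cesaroA δ k ≤ B * ((k : ℝ) + 1) ^ δ := by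
  have hG := Real.Gamma_pos_of_pos (by positivity : 0 < δ + 1)
  have h := ((tendsto_succ_rpow_div_cesaroA hδ).inv₀ hG.ne').isBigO_one ℝ
  obtain ⟨B, hB⟩ := isBigO_one_nat_atTop_iff.1 h
  refine ⟨|B| + 1, by positivity, fun k => ?_⟩
  have hk : 0 < ((k : ℝ) + 1) ^ δ := by positivity
  have h1 := (le_abs_self _).trans (hB k)
  rw [inv_div, div_le_iff₀ hk] at h1
  refine h1.trans ?_
  gcongr
  linarith [le_abs_self B]

theorem stmt_11 (δ : ℝ) (hδ : 0 < δ) :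
    ∃ c : Fin (⌈δ⌉₊ + 2) → ℝ, ∃ C > (0 : ℝ), ∀ k : ℕ,
      |cesaroA δ k -
          ∑ j, c j * ((k : ℝ) + (((j : ℕ) : ℝ) + 1) / ((⌈δ⌉₊ : ℝ) + 2)) ^ δ| ≤
        C / ((k : ℝ) + 1) ^ 2 := by
  have hG := Real.Gamma_pos_of_pos (by positivity : 0 < δ + 1)
  obtain ⟨c, C, hC, h⟩ := exists_weights_relative_error hδ (m := ⌈δ⌉₊ + 2) (by omega)
    (fun j => (((j : ℕ) : ℝ) + 1) / ((⌈δ⌉₊ : ℝ) + 2))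
    (fun i j hij => by
      have hd : (⌈δ⌉₊ : ℝ) + 2 ≠ 0 := by positivity
      have := (div_left_inj' hd).1 hij
      exact Fin.ext (by exact_mod_cast add_right_cancel this))
    (fun j => by positivity)
  obtain ⟨B, hB0, hB⟩ := exists_cesaroA_le hδ
  refine ⟨fun j => (Real.Gamma (δ + 1))⁻¹ * c j, (Real.Gamma (δ + 1))⁻¹ * (B * (C + 1)),
    by positivity, fun k => ?_⟩
  have hA := cesaroA_pos hδ k
  have hk := h k
  set S := ∑ j, c j * ((k : ℝ) + (((j : ℕ) : ℝ) + 1) / ((⌈δ⌉₊ : ℝ) + 2)) ^ δ with hS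
  have e : cesaroA δ k - ∑ j, (Real.Gamma (δ + 1))⁻¹ * c j *
      ((k : ℝ) + (((j : ℕ) : ℝ) + 1) / ((⌈δ⌉₊ : ℝ) + 2)) ^ δ =
      -((Real.Gamma (δ + 1))⁻¹ * (cesaroA δ k * (S / cesaroA δ k - Real.Gamma (δ + 1)))) := by
    simp only [mul_assoc, ← Finset.mul_sum]
    rw [← hS]
    field_simp
    ring
  have hx : (1 : ℝ) ≤ (k : ℝ) + 1 := by linarith [(Nat.cast_nonneg k : (0 : ℝ) ≤ k)]
  have hpow : ((k : ℝ) + 1) ^ δ ≤ ((k : ℝ) + 1) ^ ⌈δ⌉₊ := by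
    rw [← Real.rpow_natCast]
    exact Real.rpow_le_rpow_of_exponent_le hx (Nat.le_ceil δ)
  rw [e, abs_neg, abs_mul, abs_mul, abs_of_pos hA, abs_of_pos (inv_pos.2 hG), mul_div_assoc]
  refine mul_le_mul_of_nonneg_left ?_ (inv_pos.2 hG).le
  calc cesaroA δ k * |S / cesaroA δ k - Real.Gamma (δ + 1)|
      ≤ (B * ((k : ℝ) + 1) ^ ⌈δ⌉₊) * ((C + 1) * (1 / ((k : ℝ) + 1)) ^ (⌈δ⌉₊ + 2)) := by
        refine mul_le_mul ((hB k).trans (by gcongr)) (hk.trans ?_) (abs_nonneg _) (by positivity)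
        gcongr
        linarith
    _ = B * (C + 1) / ((k : ℝ) + 1) ^ 2 := by
        rw [one_div, inv_pow, pow_add]
        field_simp
end
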